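/- Let AT be an argumentation theory and A an argument from AT described by (G, R, p). If A is regular (no two distinct sub-arguments of A have the same conclusion), then A is minimal: there is no G' strictly contained in G with G' ⊢_R p, and no R' strictly contained in R with G ⊢_{R'} p. -/

import Mathlib

/-- A rule over the language `L`: a finite list of premises and a conclusion. -/
structure ArgRule (L : Type) where
  prems : List L
  concl : L

/-- An argumentation theory: a set of rules and a knowledge base. -/
structure ArgTheory (L : Type) where
  rules : Set (ArgRule L)
  kb : Set L

/-- Raw argument structures: either an element of the knowledge base, or an
application of a rule to a list of sub-arguments. -/
inductive Arg (L : Type) : Type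
  | atom (φ : L) : Arg L
  | node (children : List (Arg L)) (φ : L) : Arg L

namespace Arg

variable {L : Type}

/-- The conclusion of an argument. -/
def Conc : Arg L → L
  | .atom φ => φ
  | .node _ φ => φ

/-- The premises (grounds) of an argument. -/
def Prem : Arg L → Set L
  | .atom φ => {φ}
  | .node cs _ => cs.attach.foldr (fun c acc => Prem c.1 ∪ acc) ∅
decreasing_by have := List.sizeOf_lt_of_mem c.2; simp_wf; omega

/-- The set of rules used in an argument. -/
def Rules : Arg L → Set (ArgRule L)
  | .atom _ => ∅
  | .node cs φ =>
      insert ⟨cs.map Conc, φ⟩ (cs.attach.foldr (fun c acc => Rules c.1 ∪ acc) ∅)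
decreasing_by have := List.sizeOf_lt_of_mem c.2; simp_wf; omega

/-- The sub-arguments of an argument (including the argument itself). -/
def Sub : Arg L → Set (Arg L)
  | .atom φ => {.atom φ}
  | .node cs φ => insert (.node cs φ) (cs.attach.foldr (fun c acc => Sub c.1 ∪ acc) ∅)
decreasing_by have := List.sizeOf_lt_of_mem c.2; simp_wf; omega

/-- The top rule of an argument (undefined for atomic arguments). -/
def TopRule : Arg L → Option (ArgRule L)
  | .atom _ => none
  | .node cs φ => some ⟨cs.map Conc, φ⟩

/-- `A.IsArg AT` holds when `A` is a genuine argument of the theory `AT`. -/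
inductive IsArg (AT : ArgTheory L) : Arg L → Prop
  | atom {φ : L} : φ ∈ AT.kb → IsArg AT (.atom φ)
  | node {cs : List (Arg L)} {φ : L} :
      (∀ c ∈ cs, IsArg AT c) →
      (⟨cs.map Conc, φ⟩ : ArgRule L) ∈ AT.rules →
      IsArg AT (.node cs φ)

end Arg

/-- `Infers P R p` (written `P ⊢_R p`): `p` is in the closure of `P` under the
rules `R`, i.e. in the least set containing `P` and closed under `R`. -/
inductive Infers (P : Set L) (R : Set (ArgRule L)) : L → Prop
  | base {p : L} : p ∈ P → Infers P R p
  | step {r : ArgRule L} : r ∈ R → (∀ q ∈ r.prems, Infers P R q) →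
      Infers P R r.concl

namespace Arg

variable {L : Type}

/-- An argument `(G, R, p)` is minimal if no strict subset `G'` of `G` has
`G' ⊢_R p` and no strict subset `R'` of `R` has `G ⊢_{R'} p`. -/
def Minimal (A : Arg L) : Prop :=
  (¬ ∃ G' : Set L, G' ⊂ A.Prem ∧ Infers G' A.Rules A.Conc) ∧
  (¬ ∃ R' : Set (ArgRule L), R' ⊂ A.Rules ∧ Infers A.Prem R' A.Conc)

/-- An argument is regular if no two distinct sub-arguments share a conclusion. -/
def Regular (A : Arg L) : Prop :=
  ¬ ∃ A₁ ∈ A.Sub, ∃ A₂ ∈ A.Sub, A₁ ≠ A₂ ∧ A₁.Conc = A₂.Conc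

/-- An argument is circular if it has distinct sub-arguments with the same
conclusion, one of which is a sub-argument of the other. -/
def Circular (A : Arg L) : Prop :=
  ∃ A₁ ∈ A.Sub, ∃ A₂ ∈ A.Sub, A₁ ≠ A₂ ∧ A₁.Conc = A₂.Conc ∧ A₁ ∈ A₂.Sub

/-- An argument is redundant if it has distinct sub-arguments with the same
conclusion, neither of which is a sub-argument of the other. -/
def Redundant (A : Arg L) : Prop :=
  ∃ A₁ ∈ A.Sub, ∃ A₂ ∈ A.Sub, A₁ ≠ A₂ ∧ A₁.Conc = A₂.Conc ∧
    A₁ ∉ A₂.Sub ∧ A₂ ∉ A₁.Sub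

end Arg

theorem List.mem_foldr_union {α β : Type*} (f : α → Set β) (l : List α) (x : β) :
    x ∈ l.foldr (fun c acc => f c ∪ acc) ∅ ↔ ∃ c ∈ l, x ∈ f c := by
  induction l with
  | nil => simp
  | cons a l ih => simp [ih]

namespace Arg

variable {L : Type}

theorem mem_prem_node {cs : List (Arg L)} {φ p : L} :
    p ∈ (node cs φ).Prem ↔ ∃ c ∈ cs, p ∈ c.Prem := by
  rw [Prem, List.mem_foldr_union (fun c : {x // x ∈ cs} => Prem c.1)]
  simp

theorem mem_rules_node {cs : List (Arg L)} {φ : L} {r : ArgRule L} :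
    r ∈ (node cs φ).Rules ↔ r = ⟨cs.map Conc, φ⟩ ∨ ∃ c ∈ cs, r ∈ c.Rules := by
  rw [Rules, Set.mem_insert_iff, List.mem_foldr_union (fun c : {x // x ∈ cs} => Rules c.1)]
  simp

theorem mem_sub_node {cs : List (Arg L)} {φ : L} {B : Arg L} :
    B ∈ (node cs φ).Sub ↔ B = node cs φ ∨ ∃ c ∈ cs, B ∈ c.Sub := by
  rw [Sub, Set.mem_insert_iff, List.mem_foldr_union (fun c : {x // x ∈ cs} => Sub c.1)]
  simp

theorem self_mem_sub (A : Arg L) : A ∈ A.Sub := by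
  cases A with
  | atom φ => simp [Sub]
  | node cs φ => exact mem_sub_node.2 (.inl rfl)

/-- Structural induction, with the induction hypothesis for every immediate sub-argument. -/
theorem induction_on_children {motive : Arg L → Prop} (atom : ∀ φ, motive (atom φ))
    (node : ∀ cs φ, (∀ c ∈ cs, motive c) → motive (node cs φ)) : ∀ A, motive A
  | .atom φ => atom φ
  | .node cs φ => node cs φ fun c _ => induction_on_children atom node c

theorem child_mem_sub {A : Arg L} {cs : List (Arg L)} {φ : L} {c : Arg L}
    (h : node cs φ ∈ A.Sub) (hc : c ∈ cs) : c ∈ A.Sub := by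
  induction A using induction_on_children with
  | atom ψ => simp [Sub] at h
  | node ds ψ ih =>
    rw [mem_sub_node] at h ⊢
    rcases h with h | ⟨d, hd, h⟩
    · cases h
      exact .inr ⟨c, hc, self_mem_sub c⟩
    · exact .inr ⟨d, hd, ih d hd h⟩

theorem atom_mem_sub_of_mem_prem {A : Arg L} {p : L} (h : p ∈ A.Prem) : atom p ∈ A.Sub := by
  induction A using induction_on_children with
  | atom ψ => simpa [Sub, Prem] using h
  | node ds ψ ih =>
    obtain ⟨d, hd, h⟩ := mem_prem_node.1 h
    exact mem_sub_node.2 (.inr ⟨d, hd, ih d hd h⟩)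

theorem exists_node_mem_sub_of_mem_rules {A : Arg L} {r : ArgRule L} (h : r ∈ A.Rules) :
    ∃ cs φ, node cs φ ∈ A.Sub ∧ r = ⟨cs.map Conc, φ⟩ := by
  induction A using induction_on_children with
  | atom ψ => simp [Rules] at h
  | node ds ψ ih =>
    rcases mem_rules_node.1 h with h | ⟨d, hd, h⟩
    · exact ⟨ds, ψ, self_mem_sub _, h⟩
    · obtain ⟨cs, φ, hs, hr⟩ := ih d hd h
      exact ⟨cs, φ, mem_sub_node.2 (.inr ⟨d, hd, hs⟩), hr⟩

theorem Regular.eq_of_conc_eq {A B C : Arg L} (hA : A.Regular) (hB : B ∈ A.Sub)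
    (hC : C ∈ A.Sub) (h : B.Conc = C.Conc) : B = C :=
  by_contra fun hne => hA ⟨B, hB, C, hC, hne, h⟩

/-- In a regular argument, any derivation of the conclusion of a sub-argument from the premises
and rules of the whole argument uses all premises and rules of that sub-argument. -/
theorem Regular.prem_subset_and_rules_subset_of_infers {A : Arg L} (hA : A.Regular) {G : Set L}
    {R : Set (ArgRule L)} (hG : G ⊆ A.Prem) (hR : R ⊆ A.Rules) {p : L} (hp : Infers G R p)
    {B : Arg L} (hB : B ∈ A.Sub) (hBp : B.Conc = p) : B.Prem ⊆ G ∧ B.Rules ⊆ R := by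
  induction hp generalizing B with
  | base hp =>
    obtain rfl := hA.eq_of_conc_eq hB (atom_mem_sub_of_mem_prem (hG hp)) hBp
    simpa [Prem, Rules] using hp
  | step hr _ ih =>
    obtain ⟨cs, φ, hs, rfl⟩ := exists_node_mem_sub_of_mem_rules (hR hr)
    obtain rfl := hA.eq_of_conc_eq hB hs hBp
    have hc (c) (hc : c ∈ cs) : c.Prem ⊆ G ∧ c.Rules ⊆ R :=
      ih c.Conc (List.mem_map_of_mem hc) (child_mem_sub hs hc) rfl
    constructor
    · intro q hq
      obtain ⟨c, hcs, hq⟩ := mem_prem_node.1 hq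
      exact (hc c hcs).1 hq
    · intro s hs
      rcases mem_rules_node.1 hs with rfl | ⟨c, hcs, hs⟩
      · exact hr
      · exact (hc c hcs).2 hs

end Arg

/-- If an argument is regular then it is minimal. -/
theorem stmt_1 {L : Type} (AT : ArgTheory L) (A : Arg L) (hA : A.IsArg AT)
    (hreg : A.Regular) : A.Minimal := by
  constructor
  · rintro ⟨G, hG, h⟩
    exact hG.2 (hreg.prem_subset_and_rules_subset_of_infers hG.1 subset_rfl h A.self_mem_sub rfl).1
  · rintro ⟨R, hR, h⟩
    exact hR.2 (hreg.prem_subset_and_rules_subset_of_infers subset_rfl hR.1 h A.self_mem_sub rfl).2
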